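/- Let d ≥ 1 be an integer, α ∈ (0,2), and fix a > 0 and T > 0. There exists a constant ε = ε(d,α,a,T) > 0 such that for every m > 0, every t ∈ (0, T/m], and every w ∈ ℝ^d with |w| ≤ a t^{1/α}: ∫_{B(0,(t/2)^{1/α})} min(t^{−d/α}, t·j^m(|z−w|)) dz ≥ ε. -/

import Mathlib

open MeasureTheory Real

/-- `ψ(r) = 2^{-(d+α)} Γ((d+α)/2)⁻¹ ∫_0^∞ s^{(d+α)/2-1} e^{-s/4 - r²/s} ds`. -/
noncomputable def psi (d : ℕ) (α r : ℝ) : ℝ :=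
  2 ^ (-((d : ℝ) + α)) * (Real.Gamma (((d : ℝ) + α) / 2))⁻¹ *
    ∫ s in Set.Ioi (0 : ℝ), s ^ (((d : ℝ) + α) / 2 - 1) * Real.exp (-(s / 4) - r ^ 2 / s)

/-- The constant `𝒜(d,-α) = α Γ((d+α)/2) / (2^{1-α} π^{d/2} Γ(1-α/2))`. -/
noncomputable def Acoef (d : ℕ) (α : ℝ) : ℝ :=
  α * Real.Gamma (((d : ℝ) + α) / 2) /
    (2 ^ (1 - α) * Real.pi ^ ((d : ℝ) / 2) * Real.Gamma (1 - α / 2))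

/-- The Lévy density `j^m(r) = 𝒜(d,-α) r^{-(d+α)} ψ(m^{1/α} r)`. -/
noncomputable def jm (d : ℕ) (α m r : ℝ) : ℝ :=
  Acoef d α * r ^ (-((d : ℝ) + α)) * psi d α (m ^ (1 / α) * r)

theorem integrableOn_psi_integrand {p : ℝ} (hp : 0 < p) (r : ℝ) :
    IntegrableOn (fun s : ℝ => s ^ (p - 1) * Real.exp (-(s / 4) - r ^ 2 / s)) (Set.Ioi 0) := by
  have h : IntegrableOn (fun s : ℝ => s ^ (p - 1) * Real.exp (-(1 / 4) * s)) (Set.Ioi 0) := by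
    have := integrableOn_rpow_mul_exp_neg_mul_rpow (p := 1) (s := p - 1) (b := 1 / 4)
      (by linarith) one_pos (by norm_num)
    simpa using this
  refine Integrable.mono' h (Measurable.aestronglyMeasurable (by fun_prop)) ?_
  refine (ae_restrict_iff' measurableSet_Ioi).2 (ae_of_all _ fun s (hs : 0 < s) => ?_)
  rw [Real.norm_of_nonneg (by positivity)]
  gcongr
  have : 0 ≤ r ^ 2 / s := by positivity
  linarith

theorem psi_pos {d : ℕ} {α : ℝ} (hα : 0 < α) (r : ℝ) : 0 < psi d α r := by
  have hp : 0 < ((d : ℝ) + α) / 2 := by positivity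
  have hΓ := Real.Gamma_pos_of_pos hp
  have hI : 0 < ∫ s in Set.Ioi (0 : ℝ),
      s ^ (((d : ℝ) + α) / 2 - 1) * Real.exp (-(s / 4) - r ^ 2 / s) := by
    have hpos : ∀ s ∈ Set.Ioi (0 : ℝ),
        0 < s ^ (((d : ℝ) + α) / 2 - 1) * Real.exp (-(s / 4) - r ^ 2 / s) :=
      fun s (hs : 0 < s) => by positivity
    rw [setIntegral_pos_iff_support_of_nonneg_ae _ (integrableOn_psi_integrand hp r)]
    · rw [Set.inter_eq_right.2 fun s hs => Function.mem_support.2 (hpos s hs).ne']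
      simp
    · exact (ae_restrict_iff' measurableSet_Ioi).2 (ae_of_all _ fun s hs => (hpos s hs).le)
  unfold psi
  positivity

theorem psi_anti {d : ℕ} {α : ℝ} (hα : 0 < α) {r r' : ℝ} (hr : 0 ≤ r) (h : r ≤ r') :
    psi d α r' ≤ psi d α r := by
  have hp : 0 < ((d : ℝ) + α) / 2 := by positivity
  have hΓ := Real.Gamma_pos_of_pos hp
  unfold psi
  refine mul_le_mul_of_nonneg_left ?_ (by positivity)
  refine setIntegral_mono_on (integrableOn_psi_integrand hp r') (integrableOn_psi_integrand hp r)
    measurableSet_Ioi fun s (hs : 0 < s) => ?_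
  gcongr

theorem measurable_psi (d : ℕ) (α : ℝ) : Measurable (psi d α) := by
  have h : StronglyMeasurable (Function.uncurry fun r s : ℝ =>
      s ^ (((d : ℝ) + α) / 2 - 1) * Real.exp (-(s / 4) - r ^ 2 / s)) :=
    Measurable.stronglyMeasurable (by unfold Function.uncurry; fun_prop)
  exact (h.integral_prod_right (ν := volume.restrict (Set.Ioi 0))).measurable.const_mul _

theorem Acoef_pos (d : ℕ) {α : ℝ} (hα1 : 0 < α) (hα2 : α < 2) : 0 < Acoef d α := by
  have h1 : 0 < Real.Gamma (((d : ℝ) + α) / 2) := Real.Gamma_pos_of_pos (by positivity)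
  have h2 : 0 < Real.Gamma (1 - α / 2) := Real.Gamma_pos_of_pos (by linarith)
  unfold Acoef
  positivity

theorem measurable_jm (d : ℕ) (α m : ℝ) : Measurable (jm d α m) := by
  have := measurable_psi d α
  unfold jm
  fun_prop

theorem jm_nonneg (d : ℕ) {α : ℝ} (hα1 : 0 < α) (hα2 : α < 2) (m : ℝ) {r : ℝ} (hr : 0 ≤ r) :
    0 ≤ jm d α m r := by
  have := Acoef_pos d hα1 hα2
  have := psi_pos (d := d) hα1 (m ^ (1 / α) * r)
  unfold jm
  positivity

/-- On the scale `t^{1/α}` with `m t ≤ T`, the Lévy density is comparable from below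
with the stable one. -/
theorem le_mul_jm (d : ℕ) {α : ℝ} (hα1 : 0 < α) (hα2 : α < 2) {c T m t r : ℝ} (hc : 0 < c)
    (hm : 0 < m) (ht : 0 < t) (hmt : m * t ≤ T) (hr : 0 < r) (hrc : r ≤ c * t ^ (1 / α)) :
    Acoef d α * c ^ (-((d : ℝ) + α)) * psi d α (T ^ (1 / α) * c) * t ^ (-(d : ℝ) / α) ≤
      t * jm d α m r := by
  have hA := Acoef_pos d hα1 hα2
  have hψ := psi_pos (d := d) hα1 (T ^ (1 / α) * c)
  have hpsi : psi d α (T ^ (1 / α) * c) ≤ psi d α (m ^ (1 / α) * r) := by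
    refine psi_anti hα1 (by positivity) ?_
    calc m ^ (1 / α) * r ≤ m ^ (1 / α) * (c * t ^ (1 / α)) := by gcongr
      _ = (m * t) ^ (1 / α) * c := by rw [Real.mul_rpow hm.le ht.le]; ring
      _ ≤ T ^ (1 / α) * c := by gcongr
  have hpow : (c * t ^ (1 / α)) ^ (-((d : ℝ) + α)) ≤ r ^ (-((d : ℝ) + α)) :=
    Real.rpow_le_rpow_of_nonpos hr hrc (by linarith [Nat.cast_nonneg (α := ℝ) d])
  have hscale : t * (c * t ^ (1 / α)) ^ (-((d : ℝ) + α)) =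
      c ^ (-((d : ℝ) + α)) * t ^ (-(d : ℝ) / α) := by
    rw [Real.mul_rpow hc.le (by positivity), ← Real.rpow_mul ht.le, mul_left_comm,
      show t * t ^ (1 / α * -((d : ℝ) + α)) = t ^ (1 + 1 / α * -((d : ℝ) + α)) by
        rw [Real.rpow_add ht, Real.rpow_one]]
    congr 2
    field_simp
    ring
  calc _ = Acoef d α * (t * (c * t ^ (1 / α)) ^ (-((d : ℝ) + α))) *
        psi d α (T ^ (1 / α) * c) := by rw [hscale]; ring
    _ ≤ Acoef d α * (t * r ^ (-((d : ℝ) + α))) * psi d α (m ^ (1 / α) * r) := by gcongr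
    _ = t * jm d α m r := by unfold jm; ring

/-- Uniform lower bound for `∫_{B(0,(t/2)^{1/α})} min(t^{-d/α}, t j^m(|z-w|)) dz` over
`m > 0`, `t ∈ (0, T/m]` and `|w| ≤ a t^{1/α}`. -/
theorem small_time_lower_bound_integral
    (d : ℕ) (hd : 1 ≤ d) (α : ℝ) (hα1 : 0 < α) (hα2 : α < 2)
    (a T : ℝ) (ha : 0 < a) (hT : 0 < T) :
    ∃ ε : ℝ, 0 < ε ∧ ∀ m : ℝ, 0 < m → ∀ t : ℝ, t ∈ Set.Ioc 0 (T / m) →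
      ∀ w : EuclideanSpace ℝ (Fin d), ‖w‖ ≤ a * t ^ (1 / α) →
        ε ≤ ∫ z in Metric.ball (0 : EuclideanSpace ℝ (Fin d)) ((t / 2) ^ (1 / α)),
              min (t ^ (-(d : ℝ) / α)) (t * jm d α m ‖z - w‖) := by
  have hA := Acoef_pos d hα1 hα2
  have hψ := psi_pos (d := d) hα1 (T ^ (1 / α) * (1 + a))
  set K := Acoef d α * (1 + a) ^ (-((d : ℝ) + α)) * psi d α (T ^ (1 / α) * (1 + a)) with hK
  have hKpos : 0 < K := by positivity
  have : Nonempty (Fin d) := ⟨⟨0, hd⟩⟩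
  set V := volume.real (Metric.ball (0 : EuclideanSpace ℝ (Fin d)) 1)
  have hV : 0 < V :=
    ENNReal.toReal_pos (Metric.measure_ball_pos _ _ one_pos).ne' measure_ball_lt_top.ne
  refine ⟨min 1 K * (2 ^ (-(d : ℝ) / α) * V), by positivity, ?_⟩
  rintro m hm t ⟨ht, htT⟩ w hw
  have hmt : m * t ≤ T := by rwa [le_div_iff₀ hm, mul_comm] at htT
  have hball : volume.real (Metric.ball (0 : EuclideanSpace ℝ (Fin d)) ((t / 2) ^ (1 / α))) =
      (t / 2) ^ ((d : ℝ) / α) * V := by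
    rw [measureReal_def, Measure.addHaar_ball _ _ (by positivity), ENNReal.toReal_mul,
      ENNReal.toReal_ofReal (by positivity), finrank_euclideanSpace_fin,
      ← Real.rpow_mul_natCast (by positivity)]
    congr 2
    ring
  have hmeas : Measurable fun z : EuclideanSpace ℝ (Fin d) =>
      min (t ^ (-(d : ℝ) / α)) (t * jm d α m ‖z - w‖) := by
    have := measurable_jm d α m
    fun_prop
  have hint : IntegrableOn (fun z : EuclideanSpace ℝ (Fin d) =>
      min (t ^ (-(d : ℝ) / α)) (t * jm d α m ‖z - w‖))
      (Metric.ball 0 ((t / 2) ^ (1 / α))) := by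
    refine Measure.integrableOn_of_bounded (M := t ^ (-(d : ℝ) / α)) measure_ball_lt_top.ne
      hmeas.aestronglyMeasurable (ae_of_all _ fun z => ?_)
    have := jm_nonneg d hα1 hα2 m (norm_nonneg (z - w))
    rw [Real.norm_of_nonneg (by positivity)]
    exact min_le_left _ _
  calc min 1 K * (2 ^ (-(d : ℝ) / α) * V)
      = ∫ _ in Metric.ball (0 : EuclideanSpace ℝ (Fin d)) ((t / 2) ^ (1 / α)),
          min 1 K * t ^ (-(d : ℝ) / α) := by
        rw [setIntegral_const, hball, smul_eq_mul, Real.div_rpow ht.le zero_le_two, neg_div,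
          Real.rpow_neg ht.le, Real.rpow_neg zero_le_two]
        field_simp
    _ ≤ _ := by
        refine setIntegral_mono_on_ae (integrableOn_const measure_ball_lt_top.ne) hint
          measurableSet_ball ?_
        have hne : ∀ᵐ z : EuclideanSpace ℝ (Fin d), z ≠ w := by
          simp [ae_iff]
        filter_upwards [hne] with z hzw hz
        have hzn : ‖z‖ ≤ t ^ (1 / α) := by
          refine (mem_ball_zero_iff.1 hz).le.trans ?_
          gcongr
          linarith
        have hle := le_mul_jm d hα1 hα2 (c := 1 + a) (by positivity) hm ht hmt
          (norm_pos_iff.2 (sub_ne_zero.2 hzw)) (by linarith [norm_sub_le z w])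
        rw [min_mul_of_nonneg _ _ (by positivity), one_mul]
        exact min_le_min_left _ hle
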